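/- Let N be an even positive integer, k a positive even integer, f : ℍ → ℂ, and ε ∈ {+1,−1}. If f|_k H_N = ε f and f|_k U₂ = f|_k ((2,0),(0,1)), then f|_k A = −f, where A = ((−2,1),(N,−(N+2)/2)) (a matrix of determinant 2). (Lemma 3.) -/

import Mathlib

open UpperHalfPlane Matrix Complex MatrixGroups Asymptotics Filter Topology
open scoped Manifold

set_option synthInstance.maxHeartbeats 1000000 in
/-- Action of a real 2×2 matrix with positive determinant on the upper
half-plane `ℍ` (junk value `z` if the determinant is not positive). -/
noncomputable def glAct (γ : Matrix (Fin 2) (Fin 2) ℝ) (z : ℍ) : ℍ :=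
  if h : 0 < γ.det then
    (⟨Matrix.GeneralLinearGroup.mkOfDetNeZero γ h.ne', by
        simpa [Matrix.GeneralLinearGroup.mkOfDetNeZero] using h⟩ : GL(2, ℝ)⁺) • z
  else z

/-- For an even integer `k`, the weight-`k` slash action
`(f ∣ₖ γ)(z) = (det γ)^(k/2) (cz+d)^(-k) f(γz)`. -/
noncomputable def slash (k : ℤ) (γ : Matrix (Fin 2) (Fin 2) ℝ) (f : ℍ → ℂ) : ℍ → ℂ :=
  fun z => (γ.det : ℂ) ^ (k / 2) * (γ 1 0 * (z : ℂ) + γ 1 1) ^ (-k) * f (glAct γ z)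

/-- An element of `SL(2, ℤ)` as a real matrix. -/
def sl2ToReal (γ : Matrix.SpecialLinearGroup (Fin 2) ℤ) : Matrix (Fin 2) (Fin 2) ℝ :=
  (γ : Matrix (Fin 2) (Fin 2) ℤ).map (Int.cast)

/-- The function `f(z) = Σ_{n ≥ 1} a_n e^{2πinz}` on the upper half-plane. -/
noncomputable def fourierSeries (a : ℕ → ℂ) : ℍ → ℂ :=
  fun z => ∑' n : ℕ, a (n + 1) *
    Complex.exp (2 * (Real.pi : ℂ) * Complex.I * ((n : ℂ) + 1) * (z : ℂ))

/-- The Dirichlet series `F(s) = Σ_{n ≥ 1} a_n n^{-s}`. -/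
noncomputable def dirichletSeries (a : ℕ → ℂ) (s : ℂ) : ℂ :=
  ∑' n : ℕ, a (n + 1) / ((n : ℂ) + 1) ^ s

/-- The action of the Hecke operator `T_p` in weight `k`:
`f|_k T_p = f|_k ((p,0),(0,1)) + Σ_{b=0}^{p-1} f|_k ((1,b),(0,p))`. -/
noncomputable def heckeT (k : ℤ) (p : ℕ) (f : ℍ → ℂ) : ℍ → ℂ :=
  fun z => slash k !![(p : ℝ), 0; 0, 1] f z +
    ∑ b ∈ Finset.range p, slash k !![1, (b : ℝ); 0, (p : ℝ)] f z

/-- The action of the Atkin–Lehner operator `U_q` in weight `k`: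
`f|_k U_q = Σ_{b=0}^{q-1} f|_k ((q,b),(0,q))`. -/
noncomputable def atkinLehnerU (k : ℤ) (q : ℕ) (f : ℍ → ℂ) : ℍ → ℂ :=
  fun z => ∑ b ∈ Finset.range q, slash k !![(q : ℝ), (b : ℝ); 0, (q : ℝ)] f z

/-- The local factor at the prime `p` of an Euler product of degree 2,
level `N`, and weight `k`. -/
noncomputable def localFactor (a : ℕ → ℂ) (N : ℕ) (k : ℤ) (p : ℕ) (s : ℂ) : ℂ :=
  if p ∣ N then
    (if p ^ 2 ∣ N then 1 else (1 - (p : ℂ) ^ ((k : ℂ) / 2 - 1 - s))⁻¹)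
  else (1 - a p * (p : ℂ) ^ (-s) + (p : ℂ) ^ ((k : ℂ) - 1 - 2 * s))⁻¹

theorem coe_glAct {γ : Matrix (Fin 2) (Fin 2) ℝ} (h : 0 < γ.det) (z : ℍ) :
    (glAct γ z : ℂ) = (γ 0 0 * z + γ 0 1) / (γ 1 0 * z + γ 1 1) := by
  rw [glAct, dif_pos h, Subgroup.mk_smul, UpperHalfPlane.coe_smul_of_det_pos (by simpa using h)]
  rfl

theorem automorphyFactor_ne_zero {γ : Matrix (Fin 2) (Fin 2) ℝ} (h : 0 < γ.det) (z : ℍ) :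
    (γ 1 0 * z + γ 1 1 : ℂ) ≠ 0 := by
  have := UpperHalfPlane.denom_ne_zero (Matrix.GeneralLinearGroup.mkOfDetNeZero γ h.ne') z
  exact this

theorem automorphyFactor_mul {A B : Matrix (Fin 2) (Fin 2) ℝ} (hB : 0 < B.det) (z : ℍ) :
    ((A * B) 1 0 * z + (A * B) 1 1 : ℂ) =
      (A 1 0 * glAct B z + A 1 1) * (B 1 0 * z + B 1 1) := by
  have hz := automorphyFactor_ne_zero hB z
  rw [coe_glAct hB]
  simp only [Matrix.mul_apply, Fin.sum_univ_two]
  push_cast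
  field_simp
  ring

theorem glAct_mul {A B : Matrix (Fin 2) (Fin 2) ℝ} (hA : 0 < A.det) (hB : 0 < B.det) (z : ℍ) :
    glAct (A * B) z = glAct A (glAct B z) := by
  have hAB : 0 < (A * B).det := by rw [Matrix.det_mul]; positivity
  have hz := automorphyFactor_ne_zero hB z
  ext
  rw [coe_glAct hAB, automorphyFactor_mul hB, coe_glAct hA,
    mul_comm (_ + _ : ℂ), ← div_div]
  congr 1
  rw [coe_glAct hB]
  simp only [Matrix.mul_apply, Fin.sum_univ_two]
  push_cast
  field_simp
  ring

theorem slash_mul (k : ℤ) {A B : Matrix (Fin 2) (Fin 2) ℝ} (hA : 0 < A.det) (hB : 0 < B.det)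
    (f : ℍ → ℂ) : slash k (A * B) f = slash k B (slash k A f) := by
  ext z
  simp only [slash]
  rw [automorphyFactor_mul hB, glAct_mul hA hB, Matrix.det_mul, Complex.ofReal_mul,
    mul_zpow, mul_zpow]
  ring

theorem slash_smul_matrix {k : ℤ} (hk : Even k) {c : ℝ} (hc : c ≠ 0)
    {A : Matrix (Fin 2) (Fin 2) ℝ} (hA : 0 < A.det) (f : ℍ → ℂ) :
    slash k (c • A) f = slash k A f := by
  have hcA : 0 < (c • A).det := by
    rw [Matrix.det_smul, Fintype.card_fin]; positivity
  have hc' : (c : ℂ) ≠ 0 := by exact_mod_cast hc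
  ext z
  have hact : glAct (c • A) z = glAct A z := by
    ext
    rw [coe_glAct hcA, coe_glAct hA, ← mul_div_mul_left (A 0 0 * z + A 0 1 : ℂ) _ hc']
    simp only [Matrix.smul_apply, smul_eq_mul]
    push_cast
    ring
  have hden : ((c • A) 1 0 * z + (c • A) 1 1 : ℂ) = c * (A 1 0 * z + A 1 1) := by
    simp only [Matrix.smul_apply, smul_eq_mul]
    push_cast
    ring
  simp only [slash]
  rw [hact, hden, mul_zpow, Matrix.det_smul, Fintype.card_fin, Complex.ofReal_mul, mul_zpow]
  obtain ⟨m, rfl⟩ := hk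
  have hm : (m + m) / 2 = m := by lia
  have : ((c ^ 2 : ℝ) : ℂ) ^ m * (c : ℂ) ^ (-(m + m)) = 1 := by
    rw [Complex.ofReal_pow, ← zpow_natCast, ← _root_.zpow_mul, ← zpow_add₀ hc']
    convert zpow_zero _ using 2
    push_cast
    ring
  rw [hm]
  linear_combination (A.det : ℂ) ^ m * (A 1 0 * z + A 1 1 : ℂ) ^ (-(m + m)) *
    f (glAct A z) * this

theorem slash_one (k : ℤ) (f : ℍ → ℂ) : slash k 1 f = f := by
  ext z
  have : glAct 1 z = z := by
    ext
    rw [coe_glAct (by simp)]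
    simp
  simp [slash, this]

theorem slash_add (k : ℤ) (γ : Matrix (Fin 2) (Fin 2) ℝ) (f g : ℍ → ℂ) :
    slash k γ (f + g) = slash k γ f + slash k γ g := by
  ext z
  simp only [slash, Pi.add_apply]
  ring

theorem slash_smul (k : ℤ) (γ : Matrix (Fin 2) (Fin 2) ℝ) (c : ℂ) (f : ℍ → ℂ) :
    slash k γ (c • f) = c • slash k γ f := by
  ext z
  simp only [slash, Pi.smul_apply, smul_eq_mul]
  ring

theorem slash_neg (k : ℤ) (γ : Matrix (Fin 2) (Fin 2) ℝ) (f : ℍ → ℂ) :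
    slash k γ (-f) = -slash k γ f := by
  ext z
  simp only [slash, Pi.neg_apply]
  ring

theorem atkinLehnerU_two {k : ℤ} (hk : Even k) (f : ℍ → ℂ) :
    atkinLehnerU k 2 f = f + slash k !![2, 1; 0, 2] f := by
  have h : slash k !![2, 0; 0, 2] f = f := by
    have h2 : (!![2, 0; 0, 2] : Matrix (Fin 2) (Fin 2) ℝ) = (2 : ℝ) • 1 := by
      ext i j; fin_cases i <;> fin_cases j <;> simp
    rw [h2, slash_smul_matrix hk two_ne_zero (by simp), slash_one]
  ext z
  have hz := congrFun h z
  simp only [atkinLehnerU, Finset.sum_range_succ, Finset.sum_range_zero, zero_add, Pi.add_apply]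
  push_cast
  rw [hz]

/-- **Lemma 3.** If `f|_k H_N = ε f` and `f|_k U₂ = f|_k ((2,0),(0,1))`,
then `f|_k A = -f` where `A = ((-2,1),(N,-(N+2)/2))`. -/
theorem lemma_three
    (N : ℕ) (hNpos : 0 < N) (hNeven : Even N)
    (k : ℤ) (hkpos : 0 < k) (hkeven : Even k)
    (f : ℍ → ℂ) (ε : ℝ) (hε : ε = 1 ∨ ε = -1)
    (hH : slash k !![0, -1; (N : ℝ), 0] f = fun z => (ε : ℂ) * f z)
    (hU₂ : atkinLehnerU k 2 f = slash k !![2, 0; 0, 1] f) :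
    slash k !![-2, 1; (N : ℝ), -(((N : ℝ) + 2) / 2)] f = -f := by
  have hN : (0 : ℝ) < N := by exact_mod_cast hNpos
  replace hH : slash k !![0, -1; (N : ℝ), 0] f = (ε : ℂ) • f := hH
  rw [atkinLehnerU_two hkeven] at hU₂
  have hεε : (ε : ℂ) * ε = 1 := by
    rcases hε with rfl | rfl <;> simp
  have conj (B : Matrix (Fin 2) (Fin 2) ℝ) (hB : 0 < B.det) :
      slash k (!![0, -1; (N : ℝ), 0] * B * !![0, -1; (N : ℝ), 0]) f =
        (ε : ℂ) • slash k !![0, -1; (N : ℝ), 0] (slash k B f) := by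
    rw [slash_mul k (by rw [Matrix.det_mul]; simp [hN, hB]) (by simp [hN]), slash_mul k (by simp [hN]) hB, hH,
      slash_smul, slash_smul]
  have hD : slash k !![1, 0; 0, 2] f = f + slash k !![2, 0; -(N : ℝ), 2] f := by
    have h₁ : !![0, -1; (N : ℝ), 0] * !![2, 0; 0, 1] * !![0, -1; (N : ℝ), 0] =
        (-N : ℝ) • !![1, 0; 0, 2] := by
      ext i j; fin_cases i <;> fin_cases j <;> simp
    have h₂ : !![0, -1; (N : ℝ), 0] * !![2, 1; 0, 2] * !![0, -1; (N : ℝ), 0] =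
        (-N : ℝ) • !![2, 0; -(N : ℝ), 2] := by
      ext i j; fin_cases i <;> fin_cases j <;> simp; ring
    have hN' : (-N : ℝ) ≠ 0 := neg_ne_zero.mpr hN.ne'
    rw [← slash_smul_matrix hkeven hN' (by simp), ← h₁, conj _ (by simp), ← hU₂, slash_add,
      smul_add, ← conj _ (by simp), h₂, slash_smul_matrix hkeven hN' (by simp), hH, smul_smul,
      hεε, one_smul]
  have hT : slash k !![2, 1; 0, 2] f = -slash k !![4, 0; -2 * (N : ℝ), 2] f := by
    have h₁ : !![1, 0; 0, 2] * !![2, 0; 0, 1] = (2 : ℝ) • (1 : Matrix (Fin 2) (Fin 2) ℝ) := by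
      ext i j; fin_cases i <;> fin_cases j <;> simp
    have h₂ : !![2, 0; -(N : ℝ), 2] * !![2, 0; 0, 1] = !![4, 0; -2 * (N : ℝ), 2] := by
      ext i j; fin_cases i <;> fin_cases j <;> simp <;> ring
    have h := congrArg (slash k !![2, 0; 0, 1]) hD
    rw [← slash_mul k (by simp) (by simp), h₁, slash_smul_matrix hkeven two_ne_zero (by simp),
      slash_one, slash_add, ← slash_mul k (by simp) (by simp), h₂, ← hU₂, add_assoc] at h
    exact eq_neg_of_add_eq_zero_left (left_eq_add.mp h)
  have h₁ : !![2, 1; 0, 2] * !![2, -1; 0, 2] = (4 : ℝ) • (1 : Matrix (Fin 2) (Fin 2) ℝ) := by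
    ext i j; fin_cases i <;> fin_cases j <;> simp <;> norm_num
  have h₂ : !![4, 0; -2 * (N : ℝ), 2] * !![2, -1; 0, 2] =
      (-4 : ℝ) • !![-2, 1; (N : ℝ), -(((N : ℝ) + 2) / 2)] := by
    ext i j; fin_cases i <;> fin_cases j <;> simp <;> ring
  have hdet : 0 < (!![-2, 1; (N : ℝ), -(((N : ℝ) + 2) / 2)]).det := by
    rw [Matrix.det_fin_two_of]; linarith
  have h := congrArg (slash k !![2, -1; 0, 2]) hT
  rw [slash_neg, ← slash_mul k (by simp) (by simp), ← slash_mul k (by simp) (by simp), h₁, h₂,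
    slash_smul_matrix hkeven (by norm_num) (by simp), slash_one,
    slash_smul_matrix hkeven (by norm_num) hdet] at h
  exact (neg_eq_iff_eq_neg.mpr h).symm
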